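/- Let μ be a Borel probability measure on a compact interval 𝕀 ⊂ ℝ of positive length, and n ∈ ℕ. For every x ∈ Ξ_n there exists a best Lévy-distance approximation of μ given x, i.e. p* ∈ Π_n minimizing p ↦ d_L(μ, δ_x^p). Moreover, for p ∈ Π_n one has d_L(μ, δ_x^p) = min_{q∈Π_n} d_L(μ, δ_x^q) if and only if for every j = 0,…,n with x_j < x_{j+1} it holds that ℓ_{F_μ,[x_j,x_{j+1}]}(P_j) ≤ L•(x); and in this case d_L(μ, δ_x^p) = ω · L•(x). -/

import Mathlib

open MeasureTheory Filter Set

noncomputable section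

namespace BenfordApprox

/-- Right-hand limit `f₊` of a nondecreasing `f : ℝ → ℝ̄`, at an extended-real point. -/
def fplus (f : ℝ → EReal) (a : EReal) : EReal := sInf (f '' {x : ℝ | a < (x : EReal)})

/-- Left-hand limit `f₋` of a nondecreasing `f : ℝ → ℝ̄`, at an extended-real point. -/
def fminus (f : ℝ → EReal) (a : EReal) : EReal := sSup (f '' {x : ℝ | (x : EReal) < a})

/-- The (upper) inverse function `f⁻¹(t) = sup {x : f x ≤ t}` (with `sup ∅ = ⊥`). -/
def upperInv (f : ℝ → EReal) (t : ℝ) : EReal :=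
  sSup ((fun x : ℝ => (x : EReal)) '' {x : ℝ | f x ≤ (t : EReal)})

/-- The upper inverse, for an extended-real argument. -/
def upperInvE (f : ℝ → EReal) (t : EReal) : EReal :=
  sSup ((fun x : ℝ => (x : EReal)) '' {x : ℝ | f x ≤ t})

/-- Lévy-type distance `d_L(f,g)` between nondecreasing functions `f g : ℝ → ℝ̄`. -/
def dLfun (f g : ℝ → EReal) : EReal :=
  sInf ((fun y : ℝ => (y : EReal)) ''
    {y : ℝ | 0 ≤ y ∧ ∀ x : ℝ, f (x - y) - (y : EReal) ≤ g x ∧ g x ≤ f (x + y) + (y : EReal)})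

/-- The auxiliary function `ℓ_{f,I}`; it depends on `I` only through `lo = inf I`, `hi = sup I`. -/
def ell (f : ℝ → EReal) (lo hi : EReal) (x : ℝ) : ℝ :=
  sInf {y : ℝ | 0 ≤ y ∧ fminus f (hi - (y : EReal)) - (y : EReal) ≤ (x : EReal) ∧
    (x : EReal) ≤ fplus f (lo + (y : EReal)) + (y : EReal)}

/-- The minimal value `ℓ*_{f,I} = min {y ≥ 0 : f₋(sup I − y) − y ≤ f₊(inf I + y) + y}`. -/
def ellStar (f : ℝ → EReal) (lo hi : EReal) : ℝ :=
  sInf {y : ℝ | 0 ≤ y ∧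
    fminus f (hi - (y : EReal)) - (y : EReal) ≤ fplus f (lo + (y : EReal)) + (y : EReal)}

/-- Distribution function `F_μ(t) = μ {y ∈ 𝕀 : y ≤ t}` of `μ`, where `𝕀 = [A,B]`. -/
def cdf (μ : Measure ℝ) (A B : ℝ) (t : ℝ) : ℝ := (μ (Icc A B ∩ Iic t)).toReal

/-- `F_μ` evaluated at an extended-real point (so `F_μ(−∞) = 0`, `F_μ(+∞) = 1`). -/
def cdfE (μ : Measure ℝ) (A B : ℝ) (a : EReal) : ℝ :=
  (μ (Icc A B ∩ {y : ℝ | (y : EReal) ≤ a})).toReal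

/-- Left limit `F_{μ−}` at an extended-real point (so `F_{μ−}(−∞) = 0`, `F_{μ−}(+∞) = 1`). -/
def cdfL (μ : Measure ℝ) (A B : ℝ) (a : EReal) : ℝ :=
  sSup ((cdf μ A B) '' {t : ℝ | (t : EReal) < a})

/-- Left limit `F_{μ−}` at a real point. -/
def cdfm (μ : Measure ℝ) (A B : ℝ) (t : ℝ) : ℝ := sSup ((cdf μ A B) '' Iio t)

/-- The (upper) quantile function `F_μ⁻¹` of `μ` on `𝕀 = [A,B]`, extended monotonically to `ℝ`. -/
def quant (μ : Measure ℝ) (A B : ℝ) (t : ℝ) : ℝ :=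
  if t < (μ {A}).toReal ∨ t < 0 then A
  else sSup {y ∈ Icc A B | cdf μ A B y ≤ t}

/-- Left limit `F⁻¹_{μ−}` of the quantile function. -/
def quantm (μ : Measure ℝ) (A B : ℝ) (t : ℝ) : ℝ := sSup ((quant μ A B) '' Iio t)

/-- `F_μ` as a function into the extended reals. -/
def cdfEReal (μ : Measure ℝ) (A B : ℝ) : ℝ → EReal := fun t => ((cdf μ A B t : ℝ) : EReal)

/-- `F_μ⁻¹` as a function into the extended reals. -/
def quantEReal (μ : Measure ℝ) (A B : ℝ) : ℝ → EReal := fun t => ((quant μ A B t : ℝ) : EReal)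

/-- The finitely supported measure `δ_x^p = Σ_j p_j δ_{x_j}`. -/
def discr (n : ℕ) (x p : Fin n → ℝ) : Measure ℝ :=
  ∑ j : Fin n, ENNReal.ofReal (p j) • Measure.dirac (x j)

/-- `p ∈ Π_n`: a probability vector. -/
def IsPi (n : ℕ) (p : Fin n → ℝ) : Prop := (∀ j, 0 ≤ p j) ∧ ∑ j, p j = 1

/-- `x ∈ Ξ_n`: a nondecreasing vector of locations in `𝕀 = [A,B]`. -/
def IsXi (A B : ℝ) (n : ℕ) (x : Fin n → ℝ) : Prop := (∀ j, x j ∈ Icc A B) ∧ Monotone x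

/-- The uniform weight vector `u_n = (1/n, …, 1/n)`. -/
def unif (n : ℕ) : Fin n → ℝ := fun _ => 1 / (n : ℝ)

/-- Partial sums `P_i = Σ_{j<i} p_j` (so `P_0 = 0`, `P_n = 1`). -/
def psum (n : ℕ) (p : Fin n → ℝ) (i : ℕ) : ℝ := ∑ j : Fin n, if (j : ℕ) < i then p j else 0

/-- Locations extended by `x_0 = −∞`, `x_{n+1} = +∞`; here `extPts n x j` is the paper's `x_j`. -/
def extPts (n : ℕ) (x : Fin n → ℝ) : ℕ → EReal := fun j =>
  if hj : j = 0 then ⊥ else if h : j ≤ n then ((x ⟨j - 1, by omega⟩ : ℝ) : EReal) else ⊤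

/-- `xcoord n x j` is the paper's `x_{j+1}` (0-based access). -/
def xcoord (n : ℕ) (x : Fin n → ℝ) (j : ℕ) : ℝ := if h : j < n then x ⟨j, h⟩ else 0

/-- The normalizing constant `ω = max{1, λ(𝕀)}/λ(𝕀)` for `𝕀 = [A,B]`. -/
def omegaI (A B : ℝ) : ℝ := max 1 (B - A) / (B - A)

/-- Lévy distance between Borel measures on `𝕀 = [A,B]`. -/
def dLevy (A B : ℝ) (μ ν : Measure ℝ) : ℝ :=
  omegaI A B * sInf {y : ℝ | 0 ≤ y ∧
    ∀ t : ℝ, cdf μ A B (t - y) - y ≤ cdf ν A B t ∧ cdf ν A B t ≤ cdf μ A B (t + y) + y}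

/-- Kolmogorov (uniform) distance between Borel measures on `𝕀 = [A,B]`. -/
def dKol (A B : ℝ) (μ ν : Measure ℝ) : ℝ :=
  sSup (Set.range fun t : ℝ => |cdf μ A B t - cdf ν A B t|)

/-- `L¹`-Kantorovich distance between Borel measures on `𝕀 = [A,B]`. -/
def dKant1 (A B : ℝ) (μ ν : Measure ℝ) : ℝ :=
  (B - A)⁻¹ * ∫ y in Ioo (0 : ℝ) 1, |quant μ A B y - quant ν A B y|

/-- `L^r`-Kantorovich distance between Borel measures on `𝕀 = [A,B]`. -/
def dKant (A B r : ℝ) (μ ν : Measure ℝ) : ℝ :=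
  (B - A)⁻¹ * (∫ y in Ioo (0 : ℝ) 1, |quant μ A B y - quant ν A B y| ^ r) ^ (1 / r)

/-- The Benford measure `β_b` on `[1,b]`: the law of `b^U` with `U` uniform on `[0,1)`. -/
def benford (b : ℝ) : Measure ℝ := (volume.restrict (Ico (0 : ℝ) 1)).map (fun t : ℝ => b ^ t)

/-- The map `T_{f,a}(x) = f₊(f⁻¹(x+a) + 2a) + a`. -/
def Tmap (f : ℝ → EReal) (a : ℝ) : EReal → EReal :=
  fun x => fplus f (upperInvE f (x + (a : EReal)) + ((2 * a : ℝ) : EReal)) + (a : EReal)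

/-- The map `S_{f,a}(x) = f₊(f⁻¹(x+a)) + a`. -/
def Smap (f : ℝ → EReal) (a : ℝ) : EReal → EReal :=
  fun x => fplus f (upperInvE f (x + (a : EReal))) + (a : EReal)

/-- `L_•^{•,n} = min {a ≥ 0 : T_{F_μ,a}^{[n]}(0) ≥ 1}`. -/
def LBB (μ : Measure ℝ) (A B : ℝ) (n : ℕ) : ℝ :=
  sInf {a : ℝ | 0 ≤ a ∧ (1 : EReal) ≤ (Tmap (cdfEReal μ A B) a)^[n] ((0 : ℝ) : EReal)}

/-- `K_•^{•,n} = min {a ≥ 0 : S_{F_μ,a}^{[n]}(0) ≥ 1}`. -/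
def KBB (μ : Measure ℝ) (A B : ℝ) (n : ℕ) : ℝ :=
  sInf {a : ℝ | 0 ≤ a ∧ (1 : EReal) ≤ (Smap (cdfEReal μ A B) a)^[n] ((0 : ℝ) : EReal)}


/-- `L^•(x) = max {ℓ_{F_μ,[−∞,x_1]}(0), ℓ*_{F_μ,[x_1,x_2]}, …, ℓ*_{F_μ,[x_{n−1},x_n]},
ℓ_{F_μ,[x_n,+∞]}(1)}`. -/
def Lbul (μ : Measure ℝ) (A B : ℝ) (n : ℕ) (x : Fin n → ℝ) : ℝ :=
  Finset.sup' (Finset.range (n + 1)) (Finset.nonempty_range_iff.mpr (Nat.succ_ne_zero n))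
    fun j =>
      if j = 0 then ell (cdfEReal μ A B) (extPts n x 0) (extPts n x 1) 0
      else if j = n then ell (cdfEReal μ A B) (extPts n x n) (extPts n x (n + 1)) 1
      else ellStar (cdfEReal μ A B) (extPts n x j) (extPts n x (j + 1))

/-! ### Infima of closed upper sets of reals -/

/-- `S` is a nonempty set of nonnegative reals of the form `[a, ∞)`. -/
structure IsClosedRay (S : Set ℝ) : Prop where
  nonneg : ∀ y ∈ S, 0 ≤ y
  nonempty : S.Nonempty
  upper : ∀ y ∈ S, ∀ z, y ≤ z → z ∈ S
  closed : ∀ a, (∀ b, a < b → b ∈ S) → a ∈ S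

theorem IsClosedRay.sInf_le_iff {S : Set ℝ} (hS : IsClosedRay S) (a : ℝ) :
    sInf S ≤ a ↔ a ∈ S := by
  constructor
  · intro h
    refine hS.closed a fun b hb => ?_
    obtain ⟨y, hy, hyb⟩ := exists_lt_of_csInf_lt hS.nonempty (h.trans_lt hb)
    exact hS.upper y hy b hyb.le
  · exact fun h => csInf_le ⟨0, fun y hy => hS.nonneg y hy⟩ h

/-! ### Real-valued description of the sets defining `ell` and `ellStar` -/

/-- The set whose infimum is `ell`, without one-sided limits. -/
def ellSet (F : ℝ → ℝ) (lo hi : EReal) (x : ℝ) : Set ℝ :=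
  {y | 0 ≤ y ∧ (∀ s : ℝ, (s : EReal) < hi → F (s - y) - y ≤ x) ∧
    ∀ t : ℝ, lo < (t : EReal) → x ≤ F (t + y) + y}

/-- The set whose infimum is `ellStar`, without one-sided limits. -/
def ellStarSet (F : ℝ → ℝ) (lo hi : EReal) : Set ℝ :=
  {y | 0 ≤ y ∧ ∀ s : ℝ, (s : EReal) < hi → ∀ t : ℝ, lo < (t : EReal) →
    F (s - y) - y ≤ F (t + y) + y}

theorem fminus_sub_le_iff (F : ℝ → ℝ) (hi c : EReal) (y : ℝ) :
    fminus (fun t => (F t : EReal)) (hi - y) - y ≤ c ↔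
      ∀ s : ℝ, (s : EReal) < hi → ((F (s - y) - y : ℝ) : EReal) ≤ c := by
  have hsub : ∀ a : EReal, a - (y : EReal) ≤ c ↔ a ≤ c + y := fun a =>
    EReal.sub_le_iff_le_add (Or.inl (EReal.coe_ne_bot y)) (Or.inl (EReal.coe_ne_top y))
  have hlt : ∀ s : ℝ, (s : EReal) < hi - y ↔ ((s + y : ℝ) : EReal) < hi := fun s => by
    rw [EReal.coe_add]
    exact EReal.lt_sub_iff_add_lt (Or.inl (EReal.coe_ne_bot y)) (Or.inl (EReal.coe_ne_top y))
  rw [hsub, fminus, sSup_le_iff]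
  simp only [forall_mem_image, mem_ofPred_eq, hlt, EReal.coe_sub, hsub]
  exact ⟨fun h s hs => h (by simpa using hs), fun h s hs => by simpa using h (s + y) hs⟩

theorem le_fplus_add_iff (F : ℝ → ℝ) (lo c : EReal) (y : ℝ) :
    c ≤ fplus (fun t => (F t : EReal)) (lo + y) + y ↔
      ∀ t : ℝ, lo < (t : EReal) → c ≤ ((F (t + y) + y : ℝ) : EReal) := by
  have hsub : ∀ a : EReal, c ≤ a + y ↔ c - y ≤ a := fun a =>
    (EReal.sub_le_iff_le_add (Or.inl (EReal.coe_ne_bot y)) (Or.inl (EReal.coe_ne_top y))).symm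
  have hlt : ∀ s : ℝ, lo + y < (s : EReal) ↔ lo < ((s - y : ℝ) : EReal) := fun s => by
    rw [EReal.coe_sub]
    exact (EReal.lt_sub_iff_add_lt (Or.inl (EReal.coe_ne_bot y))
      (Or.inl (EReal.coe_ne_top y))).symm
  rw [hsub, fplus, le_sInf_iff]
  simp only [forall_mem_image, mem_ofPred_eq, hlt, EReal.coe_add, hsub]
  exact ⟨fun h s hs => h (by simpa using hs), fun h s hs => by simpa using h (s - y) hs⟩

theorem ell_eq_sInf_ellSet (F : ℝ → ℝ) (lo hi : EReal) (x : ℝ) :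
    ell (fun t => (F t : EReal)) lo hi x = sInf (ellSet F lo hi x) := by
  simp only [ell, ellSet, fminus_sub_le_iff, le_fplus_add_iff, EReal.coe_le_coe_iff]

theorem ellStar_eq_sInf_ellStarSet (F : ℝ → ℝ) (lo hi : EReal) :
    ellStar (fun t => (F t : EReal)) lo hi = sInf (ellStarSet F lo hi) := by
  simp only [ellStar, ellStarSet, fminus_sub_le_iff, le_fplus_add_iff, EReal.coe_le_coe_iff]
  congr! 4 with y
  exact ⟨fun h s hs t ht => h t ht s hs, fun h t ht s hs => h s hs t ht⟩

/-- A real point below `hi` and its room to move right while staying below `hi`. -/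
theorem exists_pos_add_lt {s : ℝ} {hi : EReal} (h : (s : EReal) < hi) :
    ∃ e > 0, ((s + e : ℝ) : EReal) < hi := by
  obtain ⟨r, hr, hr'⟩ := EReal.lt_iff_exists_real_btwn.1 h
  exact ⟨r - s, sub_pos.2 (EReal.coe_lt_coe_iff.1 hr), by simpa using hr'⟩

/-- A real point above `lo` and its room to move left while staying above `lo`. -/
theorem exists_pos_lt_sub {t : ℝ} {lo : EReal} (h : lo < (t : EReal)) :
    ∃ e > 0, lo < ((t - e : ℝ) : EReal) := by
  obtain ⟨r, hr, hr'⟩ := EReal.lt_iff_exists_real_btwn.1 h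
  exact ⟨t - r, sub_pos.2 (EReal.coe_lt_coe_iff.1 hr'), by simpa using hr⟩

section Monotone

variable {F : ℝ → ℝ}

theorem isClosedRay_ellSet (hF : Monotone F) (h0 : ∀ t, 0 ≤ F t) (h1 : ∀ t, F t ≤ 1)
    (lo hi : EReal) {x : ℝ} (hx : x ∈ Icc (0 : ℝ) 1) : IsClosedRay (ellSet F lo hi x) where
  nonneg y hy := hy.1
  nonempty := ⟨1, zero_le_one, fun s _ => by linarith [h1 (s - 1), hx.1],
    fun t _ => by linarith [h0 (t + 1), hx.2]⟩
  upper y hy z hz := ⟨hy.1.trans hz,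
    fun s hs => by linarith [hy.2.1 s hs, hF (show s - z ≤ s - y by linarith)],
    fun t ht => by linarith [hy.2.2 t ht, hF (show t + y ≤ t + z by linarith)]⟩
  closed a ha := by
    refine ⟨le_of_forall_gt_imp_ge_of_dense fun b hb => (ha b hb).1, fun s hs => ?_,
      fun t ht => ?_⟩
    · obtain ⟨e, he, hse⟩ := exists_pos_add_lt hs
      refine le_of_forall_pos_le_add fun d hd => ?_
      have hm : 0 < min e d := lt_min he hd
      have := (ha (a + min e d) (by linarith)).2.1 (s + e) hse
      have := hF (show s - a ≤ s + e - (a + min e d) by linarith [min_le_left e d])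
      linarith [min_le_right e d]
    · obtain ⟨e, he, hte⟩ := exists_pos_lt_sub ht
      refine le_of_forall_pos_le_add fun d hd => ?_
      have hm : 0 < min e d := lt_min he hd
      have := (ha (a + min e d) (by linarith)).2.2 (t - e) hte
      have := hF (show t - e + (a + min e d) ≤ t + a by linarith [min_le_left e d])
      linarith [min_le_right e d]

theorem isClosedRay_ellStarSet (hF : Monotone F) (h0 : ∀ t, 0 ≤ F t) (h1 : ∀ t, F t ≤ 1)
    (lo hi : EReal) : IsClosedRay (ellStarSet F lo hi) where
  nonneg y hy := hy.1
  nonempty := ⟨1, zero_le_one, fun s _ t _ => by linarith [h1 (s - 1), h0 (t + 1)]⟩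
  upper y hy z hz := ⟨hy.1.trans hz, fun s hs t ht => by
    linarith [hy.2 s hs t ht, hF (show s - z ≤ s - y by linarith),
      hF (show t + y ≤ t + z by linarith)]⟩
  closed a ha := by
    refine ⟨le_of_forall_gt_imp_ge_of_dense fun b hb => (ha b hb).1, fun s hs t ht => ?_⟩
    obtain ⟨e, he, hse⟩ := exists_pos_add_lt hs
    obtain ⟨e', he', hte⟩ := exists_pos_lt_sub ht
    refine le_of_forall_pos_le_add fun d hd => ?_
    have hm : 0 < min (min e e') (d / 2) := lt_min (lt_min he he') (by linarith)
    have hm1 := min_le_left (min e e') (d / 2)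
    have := (ha (a + min (min e e') (d / 2)) (by linarith)).2 (s + e) hse (t - e') hte
    have := hF (show s - a ≤ s + e - (a + min (min e e') (d / 2)) by
      linarith [min_le_left e e'])
    have := hF (show t - e' + (a + min (min e e') (d / 2)) ≤ t + a by
      linarith [min_le_right e e'])
    linarith [min_le_right (min e e') (d / 2)]

theorem ellSet_subset_ellStarSet (lo hi : EReal) (x : ℝ) :
    ellSet F lo hi x ⊆ ellStarSet F lo hi :=
  fun _ hy => ⟨hy.1, fun s hs t ht => (hy.2.1 s hs).trans (hy.2.2 t ht)⟩

theorem mem_ellStarSet_of_le (hF : Monotone F) {lo hi : EReal} (h : hi ≤ lo) {a : ℝ}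
    (ha : 0 ≤ a) : a ∈ ellStarSet F lo hi := by
  refine ⟨ha, fun s hs t ht => ?_⟩
  have hst : s < t := EReal.coe_lt_coe_iff.1 ((hs.trans_le h).trans ht)
  linarith [hF (show s - a ≤ t + a by linarith)]

end Monotone

/-! ### Distribution functions -/

theorem cdf_eq_probabilityTheory_cdf {A B : ℝ} (μ : Measure ℝ) [IsProbabilityMeasure μ]
    (hμ : μ (Icc A B) = 1) (t : ℝ) : cdf μ A B t = ProbabilityTheory.cdf μ t := by
  have hc : μ (Icc A B)ᶜ = 0 := (prob_compl_eq_zero_iff measurableSet_Icc).2 hμ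
  rw [ProbabilityTheory.cdf_eq_real, cdf, Measure.real, inter_comm,
    measure_inter_conull hc]

theorem le_cdf_of_forall_gt (μ : Measure ℝ) {c u : ℝ}
    (h : ∀ t, u < t → c ≤ ProbabilityTheory.cdf μ t) : c ≤ ProbabilityTheory.cdf μ u :=
  ge_of_tendsto ((ProbabilityTheory.cdf μ).right_continuous u |>.mono Ioi_subset_Ici_self)
    (eventually_nhdsWithin_of_forall h)

theorem cdf_discr {A B : ℝ} {n : ℕ} {x : Fin n → ℝ} (hx : IsXi A B n x) {p : Fin n → ℝ}
    (hp : IsPi n p) (t : ℝ) :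
    cdf (discr n x p) A B t = ∑ i, if x i ≤ t then p i else 0 := by
  have hm : MeasurableSet (Icc A B ∩ Iic t) := measurableSet_Icc.inter measurableSet_Iic
  rw [cdf, discr, Measure.finsetSum_apply, ENNReal.toReal_sum]
  · refine Finset.sum_congr rfl fun i _ => ?_
    rw [Measure.smul_apply, Measure.dirac_apply' _ hm]
    by_cases h : x i ≤ t
    · have : x i ∈ Icc A B ∩ Iic t := ⟨hx.1 i, h⟩
      simp [indicator_of_mem this, h, hp.1 i]
    · simp [h]
  · intro i _
    rw [Measure.smul_apply, Measure.dirac_apply' _ hm]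
    exact ENNReal.mul_ne_top ENNReal.ofReal_ne_top
      (by by_cases h : x i ∈ Icc A B ∩ Iic t <;> simp [indicator, h])

/-! ### The extended locations -/

theorem extPts_zero (n : ℕ) (x : Fin n → ℝ) : extPts n x 0 = ⊥ := by simp [extPts]

theorem extPts_of_gt {n j : ℕ} (x : Fin n → ℝ) (h : n < j) : extPts n x j = ⊤ := by
  simp [extPts, show j ≠ 0 by omega, show ¬ j ≤ n by omega]

theorem extPts_succ {n : ℕ} (x : Fin n → ℝ) (i : Fin n) :
    extPts n x (i + 1) = (x i : EReal) := by
  have : (i : ℕ) + 1 ≤ n := i.2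
  simp [extPts, this]

theorem extPts_eq_coe {n j : ℕ} (x : Fin n → ℝ) (h0 : j ≠ 0) (hj : j ≤ n) :
    extPts n x j = ((extPts n x j).toReal : EReal) := by
  simp [extPts, h0, hj]

theorem extPts_monotone {n : ℕ} {x : Fin n → ℝ} (hx : Monotone x) : Monotone (extPts n x) := by
  intro i j hij
  rcases eq_or_ne i 0 with rfl | hi
  · simp [extPts_zero]
  by_cases hj : j ≤ n
  · simp only [extPts, hi, show j ≠ 0 by omega, hj, hij.trans hj, dite_true, dite_false,
      EReal.coe_le_coe_iff]
    exact hx (Fin.mk_le_mk.2 (by omega))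
  · simp [extPts_of_gt x (not_le.1 hj)]

theorem extPts_zero_lt_one {n : ℕ} (hn : 0 < n) (x : Fin n → ℝ) :
    extPts n x 0 < extPts n x 1 := by
  rw [extPts_zero, extPts_eq_coe x one_ne_zero hn]
  exact EReal.bot_lt_coe _

theorem extPts_last_lt {n : ℕ} (hn : 0 < n) (x : Fin n → ℝ) :
    extPts n x n < extPts n x (n + 1) := by
  rw [extPts_of_gt x n.lt_succ_self, extPts_eq_coe x hn.ne' le_rfl]
  exact EReal.coe_lt_top _

theorem exists_extPts_le_lt (n : ℕ) (x : Fin n → ℝ) (t : ℝ) :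
    ∃ j ≤ n, extPts n x j ≤ t ∧ (t : EReal) < extPts n x (j + 1) := by
  classical
  have hex : ∃ k, (t : EReal) < extPts n x (k + 1) :=
    ⟨n, by rw [extPts_of_gt x n.lt_succ_self]; exact EReal.coe_lt_top t⟩
  refine ⟨Nat.find hex, Nat.find_min' hex ?_, ?_, Nat.find_spec hex⟩
  · rw [extPts_of_gt x n.lt_succ_self]; exact EReal.coe_lt_top t
  · rcases Nat.eq_zero_or_eq_succ_pred (Nat.find hex) with h | h
    · rw [h, extPts_zero]; exact bot_le
    · rw [h]
      exact not_lt.1 (Nat.find_min hex (m := (Nat.find hex).pred) (by omega))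

theorem cdf_discr_eq_psum {A B : ℝ} {n : ℕ} {x : Fin n → ℝ} (hx : IsXi A B n x)
    {p : Fin n → ℝ} (hp : IsPi n p) {j : ℕ} {t : ℝ} (hjt : extPts n x j ≤ t)
    (htj : (t : EReal) < extPts n x (j + 1)) :
    cdf (discr n x p) A B t = psum n p j := by
  rw [cdf_discr hx hp, psum]
  refine Finset.sum_congr rfl fun i _ => if_congr ?_ rfl rfl
  rw [← EReal.coe_le_coe_iff, ← extPts_succ]
  constructor
  · intro h
    by_contra hij
    exact absurd (h.trans_lt htj)
      (not_lt.2 (extPts_monotone hx.2 (show j + 1 ≤ (i : ℕ) + 1 by omega)))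
  · exact fun h => (extPts_monotone hx.2 (Nat.succ_le_of_lt h)).trans hjt

/-! ### Partial sums -/

theorem psum_zero (n : ℕ) (p : Fin n → ℝ) : psum n p 0 = 0 := by simp [psum]

theorem psum_last (n : ℕ) (p : Fin n → ℝ) : psum n p n = ∑ i, p i := by simp [psum]

theorem psum_mem_Icc {n : ℕ} {p : Fin n → ℝ} (hp : IsPi n p) (j : ℕ) :
    psum n p j ∈ Icc (0 : ℝ) 1 := by
  refine ⟨Finset.sum_nonneg fun i _ => ?_, ?_⟩
  · split_ifs <;> simp [hp.1 i]
  · rw [← hp.2]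
    refine Finset.sum_le_sum fun i _ => ?_
    split_ifs <;> simp [hp.1 i]

theorem psum_sub {n : ℕ} {P : ℕ → ℝ} (h0 : P 0 = 0) {j : ℕ} (hj : j ≤ n) :
    psum n (fun i => P (i + 1) - P i) j = P j := by
  have : psum n (fun i => P (i + 1) - P i) j =
      ∑ k ∈ Finset.range n, if k < j then P (k + 1) - P k else 0 :=
    Fin.sum_univ_eq_sum_range (fun k => if k < j then P (k + 1) - P k else 0) n
  rw [this, ← Finset.sum_filter,
    show (Finset.range n).filter (· < j) = Finset.range j by ext k; simp; omega,
    Finset.sum_range_sub, h0, sub_zero]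

/-! ### The Lévy distance to a discrete measure -/

theorem omegaI_pos {A B : ℝ} (hAB : A < B) : 0 < omegaI A B :=
  div_pos (lt_max_of_lt_left one_pos) (sub_pos.2 hAB)

/-- The Lévy distance without the normalizing factor. -/
def rawLevy (A B : ℝ) (μ ν : Measure ℝ) : ℝ :=
  sInf {y : ℝ | 0 ≤ y ∧
    ∀ t : ℝ, cdf μ A B (t - y) - y ≤ cdf ν A B t ∧ cdf ν A B t ≤ cdf μ A B (t + y) + y}

section Approximation

variable {A B : ℝ} {n : ℕ} {x : Fin n → ℝ} {μ : Measure ℝ} [IsProbabilityMeasure μ]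

theorem monotone_cdf (hμ : μ (Icc A B) = 1) : Monotone (cdf μ A B) := fun s t h => by
  simpa only [cdf_eq_probabilityTheory_cdf μ hμ] using ProbabilityTheory.monotone_cdf μ h

theorem cdf_nonneg {μ : Measure ℝ} (t : ℝ) : 0 ≤ cdf μ A B t := ENNReal.toReal_nonneg

theorem cdf_le_one (t : ℝ) : cdf μ A B t ≤ 1 := measureReal_le_one

theorem ell_cdf_le_iff (hμ : μ (Icc A B) = 1) (lo hi : EReal) {c : ℝ}
    (hc : c ∈ Icc (0 : ℝ) 1) (a : ℝ) :
    ell (cdfEReal μ A B) lo hi c ≤ a ↔ a ∈ ellSet (cdf μ A B) lo hi c := by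
  unfold cdfEReal
  rw [ell_eq_sInf_ellSet,
    (isClosedRay_ellSet (monotone_cdf hμ) cdf_nonneg cdf_le_one lo hi hc).sInf_le_iff]

theorem ellStar_cdf_le_iff (hμ : μ (Icc A B) = 1) (lo hi : EReal) (a : ℝ) :
    ellStar (cdfEReal μ A B) lo hi ≤ a ↔ a ∈ ellStarSet (cdf μ A B) lo hi := by
  unfold cdfEReal
  rw [ellStar_eq_sInf_ellStarSet,
    (isClosedRay_ellStarSet (monotone_cdf hμ) cdf_nonneg cdf_le_one lo hi).sInf_le_iff]

/-- The Lévy inequalities for a step function decouple over its steps. -/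
theorem levy_bounds_iff (hμ : μ (Icc A B) = 1) (hx : IsXi A B n x)
    {p : Fin n → ℝ} (hp : IsPi n p) (y : ℝ) :
    (0 ≤ y ∧ ∀ t : ℝ, cdf μ A B (t - y) - y ≤ cdf (discr n x p) A B t ∧
      cdf (discr n x p) A B t ≤ cdf μ A B (t + y) + y) ↔
    ∀ j ≤ n, extPts n x j < extPts n x (j + 1) →
      y ∈ ellSet (cdf μ A B) (extPts n x j) (extPts n x (j + 1)) (psum n p j) := by
  have hF := monotone_cdf hμ
  constructor
  · rintro ⟨hy, h⟩ j - hlt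
    obtain ⟨r, hr, hr'⟩ := EReal.lt_iff_exists_real_btwn.1 hlt
    refine ⟨hy, fun s hs => ?_, fun t ht => ?_⟩
    · have hlt' : ((max s r : ℝ) : EReal) < extPts n x (j + 1) := by
        rcases max_choice s r with e | e <;> rw [e] <;> assumption
      have hle : extPts n x j ≤ ((max s r : ℝ) : EReal) :=
        hr.le.trans (EReal.coe_le_coe_iff.2 (le_max_right s r))
      have := (h (max s r)).1
      rw [cdf_discr_eq_psum hx hp hle hlt'] at this
      linarith [hF (show s - y ≤ max s r - y by linarith [le_max_left s r])]
    · have hle : extPts n x j ≤ ((min t r : ℝ) : EReal) := by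
        rcases min_choice t r with e | e <;> rw [e] <;> exact le_of_lt (by assumption)
      have hlt' : ((min t r : ℝ) : EReal) < extPts n x (j + 1) :=
        (EReal.coe_le_coe_iff.2 (min_le_right t r)).trans_lt hr'
      have := (h (min t r)).2
      rw [cdf_discr_eq_psum hx hp hle hlt'] at this
      linarith [hF (show min t r + y ≤ t + y by linarith [min_le_left t r])]
  · intro h
    obtain ⟨j₀, hj₀, hj₀t, htj₀⟩ := exists_extPts_le_lt n x 0
    refine ⟨(h j₀ hj₀ (hj₀t.trans_lt htj₀)).1, fun t => ?_⟩
    obtain ⟨j, hj, hjt, htj⟩ := exists_extPts_le_lt n x t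
    obtain ⟨-, h1, h2⟩ := h j hj (hjt.trans_lt htj)
    rw [cdf_discr_eq_psum hx hp hjt htj]
    refine ⟨h1 t htj, ?_⟩
    rw [← sub_le_iff_le_add, cdf_eq_probabilityTheory_cdf μ hμ]
    refine le_cdf_of_forall_gt μ fun u hu => ?_
    have := h2 (u - y) (hjt.trans_lt (EReal.coe_lt_coe_iff.2 (by linarith)))
    rw [sub_add_cancel, cdf_eq_probabilityTheory_cdf μ hμ] at this
    linarith

theorem rawLevy_discr_le_iff (hμ : μ (Icc A B) = 1) (hx : IsXi A B n x)
    {p : Fin n → ℝ} (hp : IsPi n p) (a : ℝ) :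
    rawLevy A B μ (discr n x p) ≤ a ↔
    ∀ j ≤ n, extPts n x j < extPts n x (j + 1) →
      ell (cdfEReal μ A B) (extPts n x j) (extPts n x (j + 1)) (psum n p j) ≤ a := by
  have hray : ∀ j, IsClosedRay
      (ellSet (cdf μ A B) (extPts n x j) (extPts n x (j + 1)) (psum n p j)) := fun j =>
    isClosedRay_ellSet (monotone_cdf hμ) cdf_nonneg cdf_le_one _ _ (psum_mem_Icc hp j)
  simp only [ell_cdf_le_iff hμ _ _ (psum_mem_Icc hp _), rawLevy, levy_bounds_iff hμ hx hp]
  refine IsClosedRay.sInf_le_iff (S := {y | ∀ j ≤ n, extPts n x j < extPts n x (j + 1) →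
      y ∈ ellSet (cdf μ A B) (extPts n x j) (extPts n x (j + 1)) (psum n p j)})
    ⟨fun y hy => ?_, ⟨1, ?_⟩, fun y hy z hz => ?_, fun a ha => ?_⟩ a
  · exact ((levy_bounds_iff hμ hx hp y).2 hy).1
  · refine (levy_bounds_iff hμ hx hp 1).1 ⟨zero_le_one, fun t => ?_⟩
    obtain ⟨j, -, hjt, htj⟩ := exists_extPts_le_lt n x t
    rw [cdf_discr_eq_psum hx hp hjt htj]
    have := psum_mem_Icc hp j
    constructor
    · linarith [cdf_le_one (A := A) (B := B) (μ := μ) (t - 1), this.1]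
    · linarith [cdf_nonneg (A := A) (B := B) (μ := μ) (t + 1), this.2]
  · exact fun j hj hlt => (hray j).upper y (hy j hj hlt) z hz
  · exact fun j hj hlt => (hray j).closed a fun b hb => ha b hb j hj hlt

theorem Lbul_le_iff (μ : Measure ℝ) (A B : ℝ) (hn : 0 < n) (x : Fin n → ℝ) (a : ℝ) :
    Lbul μ A B n x ≤ a ↔
      ell (cdfEReal μ A B) (extPts n x 0) (extPts n x 1) 0 ≤ a ∧
      ell (cdfEReal μ A B) (extPts n x n) (extPts n x (n + 1)) 1 ≤ a ∧
      ∀ j, 0 < j → j < n → ellStar (cdfEReal μ A B) (extPts n x j) (extPts n x (j + 1)) ≤ a := by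
  rw [Lbul, Finset.sup'_le_iff]
  constructor
  · intro h
    refine ⟨by simpa using h 0 (by simp), by simpa [hn.ne'] using h n (by simp),
      fun j h0 hj => ?_⟩
    simpa [h0.ne', hj.ne] using h j (by simp; omega)
  · rintro ⟨h0, h1, h⟩ j hj
    have hj' : j ≤ n := by simpa [Nat.lt_succ_iff] using hj
    split_ifs with e e'
    · exact h0
    · exact h1
    · exact h j (by omega) (by omega)

theorem Lbul_le_rawLevy (hμ : μ (Icc A B) = 1) (hn : 0 < n) (hx : IsXi A B n x)
    {p : Fin n → ℝ} (hp : IsPi n p) : Lbul μ A B n x ≤ rawLevy A B μ (discr n x p) := by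
  have h := (rawLevy_discr_le_iff hμ hx hp _).1 le_rfl
  refine (Lbul_le_iff μ A B hn x _).2 ⟨?_, ?_, fun j _ hj => ?_⟩
  · simpa [psum_zero] using h 0 n.zero_le (extPts_zero_lt_one hn x)
  · simpa [psum_last, hp.2] using h n le_rfl (extPts_last_lt hn x)
  · rw [ellStar_cdf_le_iff hμ]
    by_cases hlt : extPts n x j < extPts n x (j + 1)
    · exact ellSet_subset_ellStarSet _ _ _
        ((ell_cdf_le_iff hμ _ _ (psum_mem_Icc hp j) _).1 (h j hj.le hlt))
    · exact mem_ellStarSet_of_le (monotone_cdf hμ) (not_lt.1 hlt)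
        (Real.sInf_nonneg fun y hy => hy.1)

/-- Clipping the upper bounds `F(x_j + L•) + L•` at `1` gives optimal cumulative weights. -/
theorem exists_rawLevy_le_Lbul (hμ : μ (Icc A B) = 1) (hn : 0 < n) (hx : IsXi A B n x) :
    ∃ p, IsPi n p ∧ rawLevy A B μ (discr n x p) ≤ Lbul μ A B n x := by
  set a := Lbul μ A B n x
  obtain ⟨h0, h1, h⟩ := (Lbul_le_iff μ A B hn x a).1 le_rfl
  have hF := monotone_cdf hμ
  have ha0 : 0 ≤ a := ((ell_cdf_le_iff hμ _ _ (by simp) _).1 h0).1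
  set P : ℕ → ℝ := fun j => if j = 0 then 0 else if n ≤ j then 1 else
    min 1 (cdf μ A B ((extPts n x j).toReal + a) + a) with hP
  have hP0 : P 0 = 0 := by simp [hP]
  have hPn : P n = 1 := by simp [hP, hn.ne']
  have hPmid : ∀ j, 0 < j → j < n →
      P j = min 1 (cdf μ A B ((extPts n x j).toReal + a) + a) := fun j hj hj' => by
    simp [hP, hj.ne', hj'.not_ge]
  have hP1 : ∀ j, P j ∈ Icc (0 : ℝ) 1 := fun j => by
    simp only [hP]
    split_ifs
    · simp
    · simp
    · exact ⟨le_min zero_le_one (add_nonneg (cdf_nonneg _) ha0), min_le_left _ _⟩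
  have hmono : ∀ j < n, P j ≤ P (j + 1) := fun j hj => by
    rcases Nat.eq_zero_or_pos j with rfl | hj0
    · rw [hP0]; exact (hP1 _).1
    rcases Nat.lt_or_ge (j + 1) n with hj1 | hj1
    · rw [hPmid j hj0 hj, hPmid (j + 1) j.succ_pos hj1]
      have hle := extPts_monotone hx.2 j.le_succ
      rw [extPts_eq_coe x hj0.ne' hj.le, extPts_eq_coe x j.succ_ne_zero hj1.le,
        EReal.coe_le_coe_iff] at hle
      exact min_le_min le_rfl (by gcongr; exact hF (by gcongr))
    · rw [show j + 1 = n by omega, hPn]; exact (hP1 j).2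
  have hp : IsPi n (fun i => P (i + 1) - P i) := by
    refine ⟨fun i => sub_nonneg.2 (hmono i i.2), ?_⟩
    rw [← psum_last, psum_sub hP0 le_rfl, hPn]
  refine ⟨_, hp, (rawLevy_discr_le_iff hμ hx hp a).2 fun j hj _ => ?_⟩
  rw [psum_sub hP0 hj]
  rcases Nat.eq_zero_or_pos j with rfl | hj0
  · rwa [hP0]
  rcases hj.eq_or_lt with rfl | hj1
  · rwa [hPn]
  rw [ell_cdf_le_iff hμ _ _ (hP1 j), hPmid j hj0 hj1]
  have hstar := ((ellStar_cdf_le_iff hμ _ _ _).1 (h j hj0 hj1)).2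
  rw [extPts_eq_coe x hj0.ne' hj1.le] at hstar ⊢
  simp only [EReal.coe_lt_coe_iff, EReal.toReal_coe] at hstar ⊢
  refine ⟨ha0, fun s hs => le_min ?_ ?_, fun t ht => ?_⟩
  · linarith [cdf_le_one (A := A) (B := B) (μ := μ) (s - a)]
  · rw [← sub_le_iff_le_add, cdf_eq_probabilityTheory_cdf μ hμ ((extPts n x j).toReal + a)]
    refine le_cdf_of_forall_gt μ fun u hu => ?_
    have := hstar s hs (u - a) (by linarith)
    rw [sub_add_cancel, cdf_eq_probabilityTheory_cdf μ hμ u] at this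
    linarith
  · have ht' : (extPts n x j).toReal < t := by simpa using ht
    refine (min_le_right _ _).trans ?_
    gcongr
    exact hF (by gcongr)

end Approximation

/-- Thm. 3.5: existence and characterization of best Lévy-distance
approximations of `μ` with prescribed locations `x ∈ Ξ_n`. -/
theorem best_dLevy_given_locations (A B : ℝ) (hAB : A < B) (μ : Measure ℝ)
    [IsProbabilityMeasure μ] (hμ : μ (Icc A B) = 1) (n : ℕ) (hn : 0 < n)
    (x : Fin n → ℝ) (hx : IsXi A B n x) :
    (∃ p : Fin n → ℝ, IsPi n p ∧ ∀ q : Fin n → ℝ, IsPi n q →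
      dLevy A B μ (discr n x p) ≤ dLevy A B μ (discr n x q)) ∧
    ∀ p : Fin n → ℝ, IsPi n p →
      (((∀ q : Fin n → ℝ, IsPi n q →
          dLevy A B μ (discr n x p) ≤ dLevy A B μ (discr n x q)) ↔
        (∀ j : ℕ, j ≤ n → extPts n x j < extPts n x (j + 1) →
          ell (cdfEReal μ A B) (extPts n x j) (extPts n x (j + 1)) (psum n p j) ≤
            Lbul μ A B n x)) ∧
      ((∀ q : Fin n → ℝ, IsPi n q →
          dLevy A B μ (discr n x p) ≤ dLevy A B μ (discr n x q)) →
        dLevy A B μ (discr n x p) = omegaI A B * Lbul μ A B n x)) := by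
  have hle : ∀ p q : Fin n → ℝ, dLevy A B μ (discr n x p) ≤ dLevy A B μ (discr n x q) ↔
      rawLevy A B μ (discr n x p) ≤ rawLevy A B μ (discr n x q) := fun p q =>
    mul_le_mul_iff_right₀ (omegaI_pos hAB)
  obtain ⟨p₀, hp₀, hp₀le⟩ := exists_rawLevy_le_Lbul hμ hn hx
  have hmin : ∀ p : Fin n → ℝ, (∀ q : Fin n → ℝ, IsPi n q →
      dLevy A B μ (discr n x p) ≤ dLevy A B μ (discr n x q)) ↔
      rawLevy A B μ (discr n x p) ≤ Lbul μ A B n x := fun p =>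
    ⟨fun h => ((hle p p₀).1 (h p₀ hp₀)).trans hp₀le,
      fun h q hq => (hle p q).2 (h.trans (Lbul_le_rawLevy hμ hn hx hq))⟩
  refine ⟨⟨p₀, hp₀, (hmin p₀).2 hp₀le⟩, fun p hp => ⟨?_, fun h => ?_⟩⟩
  · rw [hmin, rawLevy_discr_le_iff hμ hx hp]
  · exact congrArg (omegaI A B * ·)
      (((hmin p).1 h).antisymm (Lbul_le_rawLevy hμ hn hx hp))

end BenfordApprox
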